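/- arXiv:2004.12941 — 2 statements merged into one kernel-verified Lean document; each statement's English description precedes it below -/
import Mathlib

section
/- For linear (read-once) positive Boolean formulas A and B, the relation webs W(A) and W(B) are equal if and only if A and B are equivalent modulo associativity and commutativity of ∨ and ∧ (applied to arbitrary subformulas). -/
namespace BGL

/-- Positive Boolean formulas over variables in `V`. -/
inductive PBF (V : Type*) : Type _
  | var : V → PBF V
  | or  : PBF V → PBF V → PBF V
  | and : PBF V → PBF V → PBF V

namespace PBF

variable {V : Type*} [DecidableEq V]

/-- The (finite) set of variables occurring in a formula. -/
def vars : PBF V → Finset V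
  | .var x => {x}
  | .or A B => A.vars ∪ B.vars
  | .and A B => A.vars ∪ B.vars

/-- A formula is linear (read-once) if each variable occurs at most once in it. -/
def Linear : PBF V → Prop
  | .var _ => True
  | .or A B => A.Linear ∧ B.Linear ∧ Disjoint A.vars B.vars
  | .and A B => A.Linear ∧ B.Linear ∧ Disjoint A.vars B.vars

/-- Evaluation of a formula on an assignment `X ⊆ V`. -/
def eval (X : Set V) : PBF V → Prop
  | .var x => x ∈ X
  | .or A B => A.eval X ∨ B.eval X
  | .and A B => A.eval X ∧ B.eval X

/-- `x` and `y` are distinct variables of `A` whose least common connective is `∧`. -/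
def webAdj : PBF V → V → V → Prop
  | .var _, _, _ => False
  | .or A B, x, y => A.webAdj x y ∨ B.webAdj x y
  | .and A B, x, y => A.webAdj x y ∨ B.webAdj x y ∨
      (x ∈ A.vars ∧ y ∈ B.vars) ∨ (x ∈ B.vars ∧ y ∈ A.vars)

/-- The relation web of a formula: the graph on its variables with an edge between
two variables iff their least common connective is `∧`. -/
def web (A : PBF V) : SimpleGraph V := SimpleGraph.fromRel A.webAdj

/-- Equivalence of formulas modulo associativity and commutativity of `∨` and `∧`:
the smallest congruence containing the AC equations. -/
inductive AC : PBF V → PBF V → Prop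
  | refl (A : PBF V) : AC A A
  | symm {A B : PBF V} : AC A B → AC B A
  | trans {A B C : PBF V} : AC A B → AC B C → AC A C
  | orComm (A B : PBF V) : AC (.or A B) (.or B A)
  | andComm (A B : PBF V) : AC (.and A B) (.and B A)
  | orAssoc (A B C : PBF V) : AC (.or A (.or B C)) (.or (.or A B) C)
  | andAssoc (A B C : PBF V) : AC (.and A (.and B C)) (.and (.and A B) C)
  | orCongr {A A' B B' : PBF V} : AC A A' → AC B B' → AC (.or A B) (.or A' B')
  | andCongr {A A' B B' : PBF V} : AC A A' → AC B B' → AC (.and A B) (.and A' B')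

/-- A minterm of `A`: a minimal set of variables on which `A` evaluates to `1`. -/
def Minterm (A : PBF V) (S : Set V) : Prop :=
  A.eval S ∧ ∀ S' ⊆ S, A.eval S' → S' = S

/-- A maxterm of `A`: a minimal set of variables `T` such that `A` evaluates to `0`
on the complement of `T` within the variables of `A`. -/
def Maxterm (A : PBF V) (T : Set V) : Prop :=
  ¬ A.eval (↑A.vars \ T) ∧ ∀ T' ⊆ T, ¬ A.eval (↑A.vars \ T') → T' = T

end PBF

variable {V : Type*}

/-- A stable (independent) set: pairwise non-adjacent vertices. -/
def IsStable (G : SimpleGraph V) (T : Set V) : Prop :=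
  T.Pairwise fun x y => ¬ G.Adj x y

/-- A maximal clique within the vertex set `U`. -/
def MaxCliqueOn (G : SimpleGraph V) (U S : Set V) : Prop :=
  S ⊆ U ∧ G.IsClique S ∧ ∀ S' : Set V, S' ⊆ U → G.IsClique S' → S ⊆ S' → S' = S

/-- A maximal stable set within the vertex set `U`. -/
def MaxStableOn (G : SimpleGraph V) (U T : Set V) : Prop :=
  T ⊆ U ∧ IsStable G T ∧ ∀ T' : Set V, T' ⊆ U → IsStable G T' → T ⊆ T' → T' = T

namespace PBF

variable {V : Type*}

/-- The formula obtained by exchanging `∨` and `∧`. -/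
def dual : PBF V → PBF V
  | .var x => .var x
  | .or A B => .and A.dual B.dual
  | .and A B => .or A.dual B.dual

@[simp]
theorem dual_dual (A : PBF V) : A.dual.dual = A := by
  induction A <;> simp_all [dual]

theorem AC.dual {A B : PBF V} (h : AC A B) : AC A.dual B.dual := by
  induction h with
  | refl => exact .refl _
  | symm _ ih => exact ih.symm
  | trans _ _ ih₁ ih₂ => exact ih₁.trans ih₂
  | orComm => exact .andComm _ _
  | andComm => exact .orComm _ _
  | orAssoc => exact .andAssoc _ _ _
  | andAssoc => exact .orAssoc _ _ _
  | orCongr _ _ ih₁ ih₂ => exact .andCongr ih₁ ih₂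
  | andCongr _ _ ih₁ ih₂ => exact .orCongr ih₁ ih₂

theorem AC.orOrOrComm (A B C D : PBF V) :
    AC (.or (.or A B) (.or C D)) (.or (.or A C) (.or B D)) :=
  (AC.orAssoc A B _).symm.trans <|
    (AC.orCongr (.refl A) <| (AC.orAssoc B C D).trans <|
      (AC.orCongr (.orComm B C) (.refl D)).trans (AC.orAssoc C B D).symm).trans (AC.orAssoc A C _)

variable [DecidableEq V]

theorem vars_nonempty (A : PBF V) : A.vars.Nonempty := by
  induction A with
  | var x => exact Finset.singleton_nonempty x
  | or A B hA _ => exact hA.mono Finset.subset_union_left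
  | and A B hA _ => exact hA.mono Finset.subset_union_left

theorem webAdj_mem {A : PBF V} {x y : V} (h : A.webAdj x y) : x ∈ A.vars ∧ y ∈ A.vars := by
  induction A <;> grind [webAdj, vars]

theorem webAdj_symm {A : PBF V} {x y : V} (h : A.webAdj x y) : A.webAdj y x := by
  induction A <;> grind [webAdj]

theorem Linear.not_webAdj_self {A : PBF V} (hA : A.Linear) (x : V) : ¬ A.webAdj x x := by
  induction A <;> grind [webAdj, Linear, Finset.disjoint_left]

theorem Linear.web_adj {A : PBF V} (hA : A.Linear) (x y : V) : A.web.Adj x y ↔ A.webAdj x y := by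
  rw [web, SimpleGraph.fromRel_adj]
  refine ⟨fun h => h.2.elim id webAdj_symm, fun h => ⟨?_, Or.inl h⟩⟩
  rintro rfl
  exact hA.not_webAdj_self x h

theorem AC.vars_eq {A B : PBF V} (h : AC A B) : A.vars = B.vars := by
  induction h <;> grind [vars]

theorem AC.webAdj_iff {A B : PBF V} (h : AC A B) (x y : V) : A.webAdj x y ↔ B.webAdj x y := by
  induction h <;> grind [webAdj, vars, AC.vars_eq]

theorem AC.linear_iff {A B : PBF V} (h : AC A B) : A.Linear ↔ B.Linear := by
  induction h <;> grind [Linear, vars, AC.vars_eq, Finset.disjoint_left]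

@[simp]
theorem vars_dual (A : PBF V) : A.dual.vars = A.vars := by
  induction A <;> simp_all [dual, vars]

theorem Linear.dual {A : PBF V} (hA : A.Linear) : A.dual.Linear := by
  induction A <;> simp_all [PBF.dual, Linear]

theorem Linear.webAdj_dual {A : PBF V} (hA : A.Linear) (x y : V) :
    A.dual.webAdj x y ↔ x ≠ y ∧ x ∈ A.vars ∧ y ∈ A.vars ∧ ¬ A.webAdj x y := by
  induction A <;>
    grind [PBF.dual, webAdj, vars, Linear, Finset.disjoint_left, webAdj_mem, vars_dual]

/-- A set of variables without web edges to the remaining variables can be split off by a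
top-level disjunction. -/
theorem exists_AC_or_of_not_webAdj (A : PBF V) (S : Finset V)
    (h : ∀ x ∈ A.vars, ∀ y ∈ A.vars, x ∈ S → y ∉ S → ¬ A.webAdj x y) :
    A.vars ⊆ S ∨ Disjoint A.vars S ∨
      ∃ C D, AC A (.or C D) ∧ C.vars = A.vars ∩ S ∧ D.vars = A.vars \ S := by
  induction A with
  | var x => by_cases hx : x ∈ S <;> simp [vars, hx]
  | and A B ihA ihB =>
    clear ihA ihB
    obtain ⟨a, ha⟩ := A.vars_nonempty
    obtain ⟨b, hb⟩ := B.vars_nonempty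
    have hAB : ∀ x ∈ A.vars, ∀ y ∈ B.vars, (x ∈ S ↔ y ∈ S) := fun x hx y hy => by
      have hx' : x ∈ (PBF.and A B).vars := Finset.mem_union_left _ hx
      have hy' : y ∈ (PBF.and A B).vars := Finset.mem_union_right _ hy
      have hxy := h x hx' y hy'
      have hyx := h y hy' x hx'
      simp only [webAdj] at hxy hyx
      tauto
    rw [Finset.disjoint_left]
    by_cases haS : a ∈ S
    · exact .inl (by grind [vars])
    · exact .inr (.inl (by grind [vars]))
  | or A B ihA ihB =>
    have hcap : (PBF.or A B).vars ∩ S = A.vars ∩ S ∪ B.vars ∩ S := Finset.union_inter_distrib_right ..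
    have hdiff : (PBF.or A B).vars \ S = A.vars \ S ∪ B.vars \ S := Finset.union_sdiff_distrib ..
    rw [hcap, hdiff]
    have hA := ihA fun x hx y hy hxS hyS hxy =>
      h x (Finset.mem_union_left _ hx) y (Finset.mem_union_left _ hy) hxS hyS (.inl hxy)
    have hB := ihB fun x hx y hy hxS hyS hxy =>
      h x (Finset.mem_union_right _ hx) y (Finset.mem_union_right _ hy) hxS hyS (.inr hxy)
    clear ihA ihB h
    rcases hA with hA | hA | ⟨C, D, hAC, hC, hD⟩ <;>
      rcases hB with hB | hB | ⟨C', D', hAC', hC', hD'⟩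
    · exact .inl (Finset.union_subset hA hB)
    · refine .inr (.inr ⟨A, B, .refl _, ?_, ?_⟩) <;> grind [Finset.disjoint_left]
    · refine .inr (.inr ⟨.or A C', D', (AC.orCongr (.refl A) hAC').trans (.orAssoc ..), ?_, ?_⟩) <;>
        grind [vars, Finset.disjoint_left]
    · refine .inr (.inr ⟨B, A, .orComm .., ?_, ?_⟩) <;> grind [Finset.disjoint_left]
    · exact .inr (.inl (Finset.disjoint_union_left.2 ⟨hA, hB⟩))
    · refine .inr (.inr ⟨C', .or D' A, (AC.orComm ..).trans <|
        (AC.orCongr hAC' (.refl A)).trans (AC.orAssoc ..).symm, ?_, ?_⟩) <;>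
        grind [vars, Finset.disjoint_left]
    · refine .inr (.inr ⟨.or B C, D, (AC.orComm ..).trans <|
        (AC.orCongr (.refl B) hAC).trans (.orAssoc ..), ?_, ?_⟩) <;>
        grind [vars, Finset.disjoint_left]
    · refine .inr (.inr ⟨C, .or D B, (AC.orCongr hAC (.refl B)).trans (AC.orAssoc ..).symm,
        ?_, ?_⟩) <;> grind [vars, Finset.disjoint_left]
    · exact .inr (.inr ⟨.or C C', .or D D', (AC.orCongr hAC hAC').trans (.orOrOrComm ..),
        by simp [vars, hC, hC'], by simp [vars, hD, hD']⟩)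

/-- A linear formula with the variables and web of a disjunction is itself, modulo AC, a
disjunction with the same variables and webs on both sides. -/
theorem exists_AC_or_of_webAdj_iff {A₁ A₂ B : PBF V} (hA : (PBF.or A₁ A₂).Linear)
    (hB : B.Linear) (hvars : (PBF.or A₁ A₂).vars = B.vars)
    (hadj : ∀ x y, (PBF.or A₁ A₂).webAdj x y ↔ B.webAdj x y) :
    ∃ C D, AC B (.or C D) ∧ C.Linear ∧ D.Linear ∧ A₁.vars = C.vars ∧ A₂.vars = D.vars ∧
      (∀ x y, A₁.webAdj x y ↔ C.webAdj x y) ∧ ∀ x y, A₂.webAdj x y ↔ D.webAdj x y := by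
  obtain ⟨-, -, hdisj⟩ := hA
  obtain ⟨a, ha⟩ := A₁.vars_nonempty
  obtain ⟨b, hb⟩ := A₂.vars_nonempty
  rcases exists_AC_or_of_not_webAdj B A₁.vars
    (by grind [vars, webAdj, webAdj_mem, Finset.disjoint_left]) with h | h | ⟨C, D, hAC, hC, hD⟩
  · grind [vars, Finset.disjoint_left]
  · grind [vars, Finset.disjoint_left]
  · obtain ⟨hCL, hDL, -⟩ := hAC.linear_iff.1 hB
    have hC' : A₁.vars = C.vars := by grind [vars]
    have hD' : A₂.vars = D.vars := by grind [vars, Finset.disjoint_left]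
    have key (x y) : A₁.webAdj x y ∨ A₂.webAdj x y ↔ C.webAdj x y ∨ D.webAdj x y :=
      (hadj x y).trans (hAC.webAdj_iff x y)
    have hx : ∀ x ∈ A₁.vars, x ∉ A₂.vars := fun _ hx => Finset.disjoint_left.1 hdisj hx
    refine ⟨C, D, hAC, hCL, hDL, hC', hD', fun x y => ?_, fun x y => ?_⟩ <;>
    · have hxy := key x y
      have hA₁ := @webAdj_mem _ _ A₁ x y
      have hA₂ := @webAdj_mem _ _ A₂ x y
      have hC₁ := @webAdj_mem _ _ C x y
      have hD₁ := @webAdj_mem _ _ D x y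
      rw [← hC'] at hC₁
      rw [← hD'] at hD₁
      have hxx := hx x
      tauto

theorem AC.of_webAdj_iff {A B : PBF V} (hA : A.Linear) (hB : B.Linear) (hvars : A.vars = B.vars)
    (hadj : ∀ x y, A.webAdj x y ↔ B.webAdj x y) : AC A B := by
  induction A generalizing B with
  | var x =>
    cases B with
    | var y =>
      obtain rfl : x = y := Finset.singleton_injective hvars
      exact .refl _
    | or B₁ B₂ | and B₁ B₂ =>
      obtain ⟨a, ha⟩ := B₁.vars_nonempty
      obtain ⟨b, hb⟩ := B₂.vars_nonempty
      have ha' : a ∈ (PBF.var x).vars := hvars ▸ Finset.mem_union_left _ ha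
      have hb' : b ∈ (PBF.var x).vars := hvars ▸ Finset.mem_union_right _ hb
      obtain rfl := Finset.mem_singleton.1 ha'
      obtain rfl := Finset.mem_singleton.1 hb'
      exact (Finset.disjoint_left.1 hB.2.2 ha hb).elim
  | or A₁ A₂ ih₁ ih₂ =>
    obtain ⟨C, D, hAC, hC, hD, hv₁, hv₂, hw₁, hw₂⟩ := exists_AC_or_of_webAdj_iff hA hB hvars hadj
    exact (AC.orCongr (ih₁ hA.1 hC hv₁ hw₁) (ih₂ hA.2.1 hD hv₂ hw₂)).trans hAC.symm
  | and A₁ A₂ ih₁ ih₂ =>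
    have hadj' (x y) : (PBF.and A₁ A₂).dual.webAdj x y ↔ B.dual.webAdj x y := by
      rw [hA.webAdj_dual, hB.webAdj_dual, hvars, hadj]
    obtain ⟨C, D, hAC, hC, hD, hv₁, hv₂, hw₁, hw₂⟩ :=
      exists_AC_or_of_webAdj_iff hA.dual hB.dual (((PBF.and A₁ A₂).vars_dual.trans hvars).trans
        B.vars_dual.symm) hadj'
    have hw {A C : PBF V} (hA : A.Linear) (hC : C.Linear) (hv : A.dual.vars = C.vars)
        (hw : ∀ x y, A.dual.webAdj x y ↔ C.webAdj x y) (x y : V) :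
        A.webAdj x y ↔ C.dual.webAdj x y := by
      rw [hC.webAdj_dual, ← hw, ← hv, ← hA.dual.webAdj_dual, dual_dual]
    have hAC' := hAC.dual
    rw [dual_dual] at hAC'
    exact (AC.andCongr
      (ih₁ hA.1 hC.dual (by simpa using hv₁) (hw hA.1 hC hv₁ hw₁))
      (ih₂ hA.2.1 hD.dual (by simpa using hv₂) (hw hA.2.1 hD hv₂ hw₂))).trans hAC'.symm

end PBF

/-- For linear formulas, the relation webs are equal (same vertex set and same
edges) iff the formulas are equivalent modulo associativity and commutativity. -/
theorem web_eq_iff_AC {V : Type*} [DecidableEq V]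
    (A B : PBF V) (hA : A.Linear) (hB : B.Linear) :
    (A.vars = B.vars ∧ A.web = B.web) ↔ PBF.AC A B := by
  constructor
  · rintro ⟨hvars, hweb⟩
    refine .of_webAdj_iff hA hB hvars fun x y => ?_
    rw [← hA.web_adj, hweb, hB.web_adj]
  · intro h
    refine ⟨h.vars_eq, ?_⟩
    ext x y
    rw [hA.web_adj, hB.web_adj, h.webAdj_iff]

end BGL
end

section
/- Evaluation via quotients: let G be a finite simple graph (with vertices among the variables 𝒱), P a partition of V(G) into nonempty modules, and X ⊆ 𝒱 an assignment. Define Pos_P(X) = { M ∈ P : (G↾M)(X,1) } and Neg_P(X) = { M ∈ P : not (G↾M)(X,0) }, as sets of vertices of the quotient graph G/P. Then (1) G(X,1) if and only if (G/P)(Pos_P(X),1), and (2) G(X,0) if and only if (G/P)(Neg_P(X),0). -/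
namespace BGL

variable {V : Type*}

/-- A maximal clique: a clique not properly contained in any larger clique. -/
def MaxClique (G : SimpleGraph V) (S : Set V) : Prop :=
  G.IsClique S ∧ ∀ S' : Set V, G.IsClique S' → S ⊆ S' → S' = S

/-- A maximal stable set. -/
def MaxStable (G : SimpleGraph V) (T : Set V) : Prop :=
  IsStable G T ∧ ∀ T' : Set V, IsStable G T' → T ⊆ T' → T' = T

/-- `G(X,1)`: some maximal clique of `G` is contained in `X`. -/
def EvalOne (G : SimpleGraph V) (X : Set V) : Prop :=
  ∃ S, MaxClique G S ∧ S ⊆ X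

/-- `G(X,0)`: some maximal stable set of `G` is disjoint from `X`. -/
def EvalZero (G : SimpleGraph V) (X : Set V) : Prop :=
  ∃ T, MaxStable G T ∧ T ∩ X = ∅

/-- Conjunctive entailment `G ⊨∧ H`. -/
def EntailsAnd (G H : SimpleGraph V) : Prop :=
  ∀ S, MaxClique G S → ∃ S', MaxClique H S' ∧ S' ⊆ S

/-- Disjunctive entailment `G ⊨∨ H`. -/
def EntailsOr (G H : SimpleGraph V) : Prop :=
  ∀ T, MaxStable H T → ∃ T', MaxStable G T' ∧ T' ⊆ T

/-- `G` is deterministic: no assignment evaluates to both 0 and 1. -/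
def Deterministic (G : SimpleGraph V) : Prop :=
  ¬ ∃ X : Set V, EvalZero G X ∧ EvalOne G X

/-- `G` is total: every assignment evaluates to 0 or 1. -/
def Total (G : SimpleGraph V) : Prop :=
  ∀ X : Set V, EvalZero G X ∨ EvalOne G X

/-- `G` is CIS: every maximal clique and maximal stable set intersect. -/
def CIS (G : SimpleGraph V) : Prop :=
  ∀ S T : Set V, MaxClique G S → MaxStable G T → (S ∩ T).Nonempty

/-- `M` is a module of `G`: every outside vertex treats all of `M` uniformly. -/
def IsModule (G : SimpleGraph V) (M : Set V) : Prop :=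
  ∀ z ∉ M, ∀ x ∈ M, ∀ y ∈ M, (G.Adj z x ↔ G.Adj z y)

/-- The quotient graph of `G` by a (modular) partition `P`: parts are adjacent iff
some (equivalently, for modules, every) pair of their vertices is adjacent. -/
def QuotGraph (G : SimpleGraph V) (P : Set (Set V)) : SimpleGraph {M // M ∈ P} :=
  SimpleGraph.fromRel fun M N => ∃ x ∈ M.1, ∃ y ∈ N.1, G.Adj x y

theorem maxClique_iff {V : Type*} {G : SimpleGraph V} {S : Set V} :
    MaxClique G S ↔ G.IsClique S ∧ ∀ v, (∀ s ∈ S, v ≠ s → G.Adj v s) → v ∈ S := by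
  refine and_congr_right fun hS => ⟨fun h v hv => ?_, fun h S' hS' hsub => ?_⟩
  · exact h _ (hS.insert hv) (Set.subset_insert v S) ▸ Set.mem_insert v S
  · exact (hsub.antisymm fun v hv => h v fun s hs hne => hS' hv (hsub hs) hne).symm

theorem maxCliqueOn_iff {V : Type*} {G : SimpleGraph V} {U S : Set V} :
    MaxCliqueOn G U S ↔
      S ⊆ U ∧ G.IsClique S ∧ ∀ v ∈ U, (∀ s ∈ S, v ≠ s → G.Adj v s) → v ∈ S := by
  refine and_congr_right fun hU => and_congr_right fun hS =>
    ⟨fun h v hvU hv => ?_, fun h S' hU' hS' hsub => ?_⟩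
  · exact h _ (Set.insert_subset hvU hU) (hS.insert hv) (Set.subset_insert v S) ▸
      Set.mem_insert v S
  · exact (hsub.antisymm fun v hv =>
      h v (hU' hv) fun s hs hne => hS' hv (hsub hs) hne).symm

theorem MaxCliqueOn.nonempty {V : Type*} {G : SimpleGraph V} {U S : Set V}
    (hS : MaxCliqueOn G U S) (hU : U.Nonempty) : S.Nonempty := by
  obtain ⟨u, hu⟩ := hU
  by_contra hne
  rw [Set.not_nonempty_iff_eq_empty] at hne
  subst hne
  simpa using (maxCliqueOn_iff.1 hS).2.2 u hu

theorem isStable_iff_isClique_compl {V : Type*} {G : SimpleGraph V} {T : Set V} :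
    IsStable G T ↔ Gᶜ.IsClique T := by
  refine ⟨fun h x hx y hy hne => ?_, fun h x hx y hy hne => ?_⟩
  · exact (SimpleGraph.compl_adj ..).2 ⟨hne, h hx hy hne⟩
  · exact ((SimpleGraph.compl_adj ..).1 (h hx hy hne)).2

theorem maxStable_iff_maxClique_compl {V : Type*} {G : SimpleGraph V} {T : Set V} :
    MaxStable G T ↔ MaxClique Gᶜ T := by
  simp only [MaxStable, MaxClique, isStable_iff_isClique_compl]

theorem maxStableOn_iff_maxCliqueOn_compl {V : Type*} {G : SimpleGraph V} {U T : Set V} :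
    MaxStableOn G U T ↔ MaxCliqueOn Gᶜ U T := by
  simp only [MaxStableOn, MaxCliqueOn, isStable_iff_isClique_compl]

theorem evalZero_iff_evalOne_compl {V : Type*} {G : SimpleGraph V} {X : Set V} :
    EvalZero G X ↔ EvalOne Gᶜ Xᶜ := by
  simp only [EvalZero, EvalOne, maxStable_iff_maxClique_compl, Set.subset_compl_iff_disjoint_right,
    Set.disjoint_iff_inter_eq_empty]

/-- Evaluation to `1` via any graph `H` on the parts of a partition whose adjacency between
distinct parts agrees with that of all pairs of their vertices. -/
theorem evalOne_iff_of_adj_iff {V : Type*} {G : SimpleGraph V} {P : Set (Set V)}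
    {H : SimpleGraph {M // M ∈ P}} (hne : ∀ M ∈ P, M.Nonempty)
    (hdisj : ∀ M ∈ P, ∀ N ∈ P, M ≠ N → Disjoint M N) (hcover : ⋃₀ P = Set.univ)
    (hH : ∀ M N : {M // M ∈ P}, M ≠ N → ∀ x ∈ M.1, ∀ y ∈ N.1, (H.Adj M N ↔ G.Adj x y))
    (X : Set V) :
    EvalOne G X ↔ EvalOne H {M | ∃ S, MaxCliqueOn G M.1 S ∧ S ⊆ X} := by
  have hpart (v : V) : ∃ M : {M // M ∈ P}, v ∈ M.1 := by
    obtain ⟨M, hM, hv⟩ := Set.mem_sUnion.1 (hcover ▸ Set.mem_univ v)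
    exact ⟨⟨M, hM⟩, hv⟩
  have huniq {M N : {M // M ∈ P}} (hMN : M ≠ N) {x y : V} (hx : x ∈ M.1) (hy : y ∈ N.1) :
      x ≠ y :=
    (hdisj M.1 M.2 N.1 N.2 fun h => hMN (Subtype.ext h)).ne_of_mem hx hy
  constructor
  · rintro ⟨S, hS, hSX⟩
    rw [maxClique_iff] at hS
    obtain ⟨hS, hmax⟩ := hS
    refine ⟨{M | (M.1 ∩ S).Nonempty}, maxClique_iff.2 ⟨?_, fun N hN => ?_⟩, ?_⟩
    · rintro M ⟨x, hxM, hxS⟩ N ⟨y, hyN, hyS⟩ hMN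
      exact (hH M N hMN x hxM y hyN).2 (hS hxS hyS (huniq hMN hxM hyN))
    · by_contra hNS
      obtain ⟨n, hn⟩ := hne N.1 N.2
      refine hNS ⟨n, hn, hmax n fun s hs _ => ?_⟩
      obtain ⟨M, hsM⟩ := hpart s
      have hNM : N ≠ M := by
        rintro rfl
        exact hNS ⟨s, hsM, hs⟩
      exact (hH N M hNM n hn s hsM).1 (hN M ⟨s, hsM, hs⟩ hNM)
    · rintro M ⟨x, hxM, hxS⟩
      refine ⟨M.1 ∩ S, maxCliqueOn_iff.2 ⟨Set.inter_subset_left,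
        hS.subset Set.inter_subset_right, fun v hv hadj => ⟨hv, hmax v fun s hs hvs => ?_⟩⟩,
        Set.inter_subset_right.trans hSX⟩
      obtain ⟨N, hsN⟩ := hpart s
      by_cases hMN : M = N
      · subst hMN
        exact hadj s ⟨hsN, hs⟩ hvs
      · exact (hH M N hMN v hv s hsN).1
          ((hH M N hMN x hxM s hsN).2 (hS hxS hs (huniq hMN hxM hsN)))
  · rintro ⟨K, hK, hKX⟩
    rw [maxClique_iff] at hK
    obtain ⟨hK, hmax⟩ := hK
    have hex : ∀ M ∈ K, ∃ S, MaxCliqueOn G M.1 S ∧ S ⊆ X := fun M hM => hKX hM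
    choose! S hS hSX using hex
    refine ⟨{v | ∃ M ∈ K, v ∈ S M}, maxClique_iff.2 ⟨?_, fun v hv => ?_⟩, ?_⟩
    · rintro x ⟨M, hM, hx⟩ y ⟨N, hN, hy⟩ hxy
      by_cases hMN : M = N
      · subst hMN
        exact (hS M hM).2.1 hx hy hxy
      · exact (hH M N hMN x ((hS M hM).1 hx) y ((hS N hN).1 hy)).1 (hK hM hN hMN)
    · obtain ⟨M, hvM⟩ := hpart v
      have hM : M ∈ K := hmax M fun N hN hMN => by
        obtain ⟨s, hs⟩ := (hS N hN).nonempty (hne N.1 N.2)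
        have hsN := (hS N hN).1 hs
        exact (hH M N hMN v hvM s hsN).2 (hv s ⟨N, hN, hs⟩ (huniq hMN hvM hsN))
      exact ⟨M, hM, (maxCliqueOn_iff.1 (hS M hM)).2.2 v hvM fun s hs => hv s ⟨M, hM, hs⟩⟩
    · rintro v ⟨M, hM, hv⟩
      exact hSX M hM hv

theorem quotGraph_adj_iff {V : Type*} {G : SimpleGraph V} {P : Set (Set V)}
    (hP : ∀ M ∈ P, IsModule G M) (hdisj : ∀ M ∈ P, ∀ N ∈ P, M ≠ N → Disjoint M N)
    {M N : {M // M ∈ P}} (hMN : M ≠ N) {x y : V} (hx : x ∈ M.1) (hy : y ∈ N.1) :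
    (QuotGraph G P).Adj M N ↔ G.Adj x y := by
  have hd : Disjoint M.1 N.1 := hdisj M.1 M.2 N.1 N.2 fun h => hMN (Subtype.ext h)
  have key {a b : V} (ha : a ∈ M.1) (hb : b ∈ N.1) (hab : G.Adj a b) : G.Adj x y := by
    have hbx : G.Adj b x := (hP M.1 M.2 b (hd.notMem_of_mem_right hb) a ha x hx).1 hab.symm
    exact (hP N.1 N.2 x (hd.notMem_of_mem_left hx) b hb y hy).1 hbx.symm
  rw [QuotGraph, SimpleGraph.fromRel_adj]
  constructor
  · rintro ⟨-, ⟨a, ha, b, hb, hab⟩ | ⟨b, hb, a, ha, hab⟩⟩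
    · exact key ha hb hab
    · exact key ha hb hab.symm
  · exact fun h => ⟨hMN, Or.inl ⟨x, hx, y, hy, h⟩⟩

/-- Evaluation via quotients by a modular partition. -/
theorem eval_via_quotient {V : Type*} [Fintype V] (G : SimpleGraph V) (P : Set (Set V))
    (hP : ∀ M ∈ P, M.Nonempty ∧ IsModule G M)
    (hdisj : ∀ M ∈ P, ∀ N ∈ P, M ≠ N → Disjoint M N)
    (hcover : ⋃₀ P = Set.univ) (X : Set V) :
    (EvalOne G X ↔
      EvalOne (QuotGraph G P) {M : {M // M ∈ P} | ∃ S, MaxCliqueOn G M.1 S ∧ S ⊆ X}) ∧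
    (EvalZero G X ↔
      EvalZero (QuotGraph G P) {M : {M // M ∈ P} | ¬ ∃ T, MaxStableOn G M.1 T ∧ T ∩ X = ∅}) := by
  have hne : ∀ M ∈ P, M.Nonempty := fun M hM => (hP M hM).1
  have hadj (M N : {M // M ∈ P}) (hMN : M ≠ N) (x : V) (hx : x ∈ M.1) (y : V) (hy : y ∈ N.1) :
      (QuotGraph G P).Adj M N ↔ G.Adj x y :=
    quotGraph_adj_iff (fun M hM => (hP M hM).2) hdisj hMN hx hy
  refine ⟨evalOne_iff_of_adj_iff hne hdisj hcover hadj X, ?_⟩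
  rw [evalZero_iff_evalOne_compl, evalZero_iff_evalOne_compl,
    evalOne_iff_of_adj_iff (H := (QuotGraph G P)ᶜ) hne hdisj hcover
      (fun M N hMN x hx y hy => ?_) Xᶜ]
  · simp only [Set.compl_ofPred, not_not, maxStableOn_iff_maxCliqueOn_compl,
      Set.subset_compl_iff_disjoint_right, Set.disjoint_iff_inter_eq_empty]
  · have hxy : x ≠ y :=
      (hdisj M.1 M.2 N.1 N.2 fun h => hMN (Subtype.ext h)).ne_of_mem hx hy
    simp only [SimpleGraph.compl_adj, hadj M N hMN x hx y hy, ne_eq, hMN, hxy]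

end BGL
end
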